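/- Let M ∈ ℝ^{3×3} be the matrix with rows (0,1,1), (1,0,0), (1,0,0). Then the infimum of ‖X − M‖_F over all X ∈ LS_3(1,1) equals 0, yet there is no X ∈ LS_3(1,1) with ‖X − M‖_F = 0; that is, the Robust PCA problem min_{X ∈ LS_3(1,1)} ‖X − M‖_F has no minimizer. -/

import Mathlib

open Matrix

/-- The number of nonzero entries of a matrix (the "ℓ₀ norm"). -/
noncomputable def sparsity {I J : Type*} [Fintype I] [Fintype J] (S : Matrix I J ℝ) : ℕ :=
  Nat.card {p : I × J // S p.1 p.2 ≠ 0}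

/-- The set of `m × n` real matrices expressible as a rank `≤ r` matrix plus a
matrix with at most `s` nonzero entries. -/
def LS (m n r s : ℕ) : Set (Matrix (Fin m) (Fin n) ℝ) :=
  {M | ∃ L S : Matrix (Fin m) (Fin n) ℝ, M = L + S ∧ L.rank ≤ r ∧ sparsity S ≤ s}

/-- The matrix rigidity: minimal number of entries that must be changed to reduce
the rank to at most `r`. -/
noncomputable def Rig {I J : Type*} [Fintype I] [Fintype J] (M : Matrix I J ℝ) (r : ℕ) : ℕ :=
  sInf {k | ∃ S : Matrix I J ℝ, (M - S).rank ≤ r ∧ sparsity S = k}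

/-- The Frobenius norm of a matrix. -/
noncomputable def frobNorm {I J : Type*} [Fintype I] [Fintype J] (A : Matrix I J ℝ) : ℝ :=
  Real.sqrt (∑ i, ∑ j, (A i j) ^ 2)

/-- Every `2 × 2` minor of a matrix of rank at most one vanishes. -/
theorem minor_eq_zero_of_rank_le_one {I J : Type*} [Fintype I] [Fintype J] {L : Matrix I J ℝ}
    (hL : L.rank ≤ 1) (i i' : I) (j j' : J) : L i j * L i' j' - L i j' * L i' j = 0 := by
  by_contra h
  have hdet : IsUnit (L.submatrix ![i, i'] ![j, j']) := by
    rw [Matrix.isUnit_iff_isUnit_det, Matrix.det_fin_two, isUnit_iff_ne_zero]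
    simpa using h
  have hrank := Matrix.rank_of_isUnit _ hdet
  have hle := Matrix.rank_submatrix_le L ![i, i'] ![j, j']
  simp only [Fintype.card_fin] at hrank
  omega

/-- A matrix with at most one nonzero entry has only one possible position for it. -/
theorem eq_of_sparsity_le_one {I J : Type*} [Fintype I] [Fintype J] {S : Matrix I J ℝ}
    (hS : sparsity S ≤ 1) {p q : I × J} (hp : S p.1 p.2 ≠ 0) (hq : S q.1 q.2 ≠ 0) : p = q := by
  have hsub := Finite.card_le_one_iff_subsingleton.mp hS
  exact congrArg Subtype.val
    (Subsingleton.elim (⟨p, hp⟩ : {p : I × J // S p.1 p.2 ≠ 0}) ⟨q, hq⟩)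

theorem sparsity_single_le_one {I J : Type*} [Fintype I] [Fintype J] [DecidableEq I]
    [DecidableEq J] (i : I) (j : J) (c : ℝ) : sparsity (Matrix.single i j c) ≤ 1 := by
  refine Finite.card_le_one_iff_subsingleton.mpr ⟨fun p q => ?_⟩
  have key : ∀ p : {p : I × J // Matrix.single i j c p.1 p.2 ≠ 0}, p.1 = (i, j) := by
    rintro ⟨⟨a, b⟩, hab⟩
    by_contra hne
    refine hab (Matrix.single_apply_of_ne _ _ _ _ _ ?_)
    rintro ⟨rfl, rfl⟩
    exact hne rfl
  exact Subtype.ext ((key p).trans (key q).symm)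

theorem eq_of_frobNorm_sub_eq_zero {I J : Type*} [Fintype I] [Fintype J] {A B : Matrix I J ℝ}
    (h : frobNorm (A - B) = 0) : A = B := by
  have hnonneg : ∀ i ∈ Finset.univ, 0 ≤ ∑ j, ((A - B) i j) ^ 2 :=
    fun i _ => Finset.sum_nonneg fun j _ => sq_nonneg _
  rw [frobNorm, Real.sqrt_eq_zero (Finset.sum_nonneg hnonneg),
    Finset.sum_eq_zero_iff_of_nonneg hnonneg] at h
  ext i j
  have hij := (Finset.sum_eq_zero_iff_of_nonneg fun j _ => sq_nonneg _).mp
    (h i (Finset.mem_univ i)) j (Finset.mem_univ j)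
  exact sub_eq_zero.mp (pow_eq_zero_iff two_ne_zero |>.mp hij)

theorem perturbation_mem_LS {t : ℝ} (ht : t ≠ 0) :
    (!![0, 1, 1; 1, t, t; 1, t, t] : Matrix (Fin 3) (Fin 3) ℝ) ∈ LS 3 3 1 1 := by
  refine ⟨Matrix.vecMulVec ![t⁻¹, 1, 1] ![1, t, t], Matrix.single 0 0 (-t⁻¹), ?_,
    Matrix.rank_vecMulVec_le _ _, sparsity_single_le_one _ _ _⟩
  ext i j
  fin_cases i <;> fin_cases j <;> simp [ht]

theorem frobNorm_perturbation_sub {t : ℝ} (ht : 0 ≤ t) :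
    frobNorm ((!![0, 1, 1; 1, t, t; 1, t, t] : Matrix (Fin 3) (Fin 3) ℝ)
      - !![0, 1, 1; 1, 0, 0; 1, 0, 0]) = 2 * t := by
  rw [frobNorm, Real.sqrt_eq_iff_mul_self_eq (by positivity) (by positivity)]
  simp [Fin.sum_univ_three]
  ring

theorem not_mem_LS_three_one_one :
    (!![0, 1, 1; 1, 0, 0; 1, 0, 0] : Matrix (Fin 3) (Fin 3) ℝ) ∉ LS 3 3 1 1 := by
  rintro ⟨L, S, hM, hL, hS⟩
  have hentry := fun i j => congrFun (congrFun hM i) j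
  have key : ∀ i j : Fin 3, i ≠ 0 → j ≠ 0 → S 0 j ≠ 0 ∨ S i 0 ≠ 0 ∨ S i j ≠ 0 := by
    intro i j hi hj
    by_contra! ⟨h1, h2, h3⟩
    have hminor := minor_eq_zero_of_rank_le_one hL 0 i 0 j
    have e1 := hentry 0 j
    have e2 := hentry i 0
    have e3 := hentry i j
    simp only [Matrix.add_apply, h1, h2, h3, add_zero] at e1 e2 e3
    rw [← e1, ← e2, ← e3] at hminor
    fin_cases i <;> fin_cases j <;> simp at hi hj hminor
  have h11 := key 1 1 (by decide) (by decide)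
  have h22 := key 2 2 (by decide) (by decide)
  have huniq : ∀ a b c d : Fin 3, S a b ≠ 0 → S c d ≠ 0 → (a, b) = (c, d) :=
    fun a b c d hp hq => eq_of_sparsity_le_one hS (p := (a, b)) (q := (c, d)) hp hq
  rcases h11 with h | h | h <;> rcases h22 with h' | h' | h' <;>
    exact absurd (huniq _ _ _ _ h h') (by decide)

/-- The Robust PCA problem `min_{X ∈ LS_3(1,1)} ‖X − M‖_F` for `M` with rows
`(0,1,1), (1,0,0), (1,0,0)` has infimum `0` but no minimizer. -/
theorem robust_pca_no_minimizer :
    sInf ((fun X : Matrix (Fin 3) (Fin 3) ℝ =>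
        frobNorm (X - (!![0, 1, 1; 1, 0, 0; 1, 0, 0] : Matrix (Fin 3) (Fin 3) ℝ)))
      '' LS 3 3 1 1) = 0 ∧
    ¬ ∃ X ∈ LS 3 3 1 1,
        frobNorm (X - (!![0, 1, 1; 1, 0, 0; 1, 0, 0] : Matrix (Fin 3) (Fin 3) ℝ)) = 0 := by
  refine ⟨le_antisymm (le_of_forall_pos_le_add fun ε hε => ?_) ?_, ?_⟩
  · rw [zero_add]
    refine csInf_le ⟨0, ?_⟩ ⟨_, perturbation_mem_LS (half_pos hε).ne', ?_⟩
    · rintro _ ⟨X, -, rfl⟩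
      exact Real.sqrt_nonneg _
    · exact (frobNorm_perturbation_sub (half_pos hε).le).trans (mul_div_cancel₀ ε two_ne_zero)
  · refine Real.sInf_nonneg ?_
    rintro _ ⟨X, -, rfl⟩
    exact Real.sqrt_nonneg _
  · rintro ⟨X, hX, h⟩
    exact not_mem_LS_three_one_one (eq_of_frobNorm_sub_eq_zero h ▸ hX)
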